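/- arXiv:1610.03194 — 3 statements merged into one kernel-verified Lean document; each statement's English description precedes it below -/
import Mathlib

section
/- Let m ∈ ℕ, let κ : Fin m → ℝ, and let x ∈ ℝ with x > 0. Define the m×m real matrix W by W(i, j) = (∏_{l=0}^{j−1} (κ(i) − l)) · x^{κ(i) − j} for i ∈ Fin m and j ∈ {0, 1, …, m−1} (the empty product for j = 0 being 1). Then det W = x^{(Σ_{i} κ(i)) − m(m−1)/2} · ∏_{i < j} (κ(j) − κ(i)), where the product is over ordered pairs i < j in Fin m. -/
open Finset in
/-- the generalized Vandermonde identity for the Wronskian of the power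
functions `x^{κ i}`: its `(i,j)` entry is `κ(i)(κ(i)−1)⋯(κ(i)−j+1)·x^{κ(i)−j}`, and its
determinant is `x^{Σκ − m(m−1)/2} ∏_{i<j} (κ(j) − κ(i))`. -/
theorem wronskian_of_powers_det
    (m : ℕ) (κ : Fin m → ℝ) (x : ℝ) (hx : 0 < x) :
    (Matrix.of fun i j : Fin m =>
        (∏ l ∈ Finset.range (j : ℕ), (κ i - (l : ℝ))) * x ^ (κ i - (j : ℕ))).det
      = x ^ ((∑ i, κ i) - (m : ℝ) * ((m : ℝ) - 1) / 2) *
          ∏ i : Fin m, ∏ j ∈ Finset.univ.filter (fun j => i < j), (κ j - κ i) := by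
  have h1 : (Matrix.of fun i j : Fin m =>
        (∏ l ∈ Finset.range (j : ℕ), (κ i - (l : ℝ))) * x ^ (κ i - (j : ℕ)))
      = Matrix.of fun i j : Fin m => x ^ (κ i) *
          (Matrix.of fun i j : Fin m => x ^ (-((j : ℕ) : ℝ)) *
            (Matrix.of fun i j : Fin m =>
              (descPochhammer ℝ (j : ℕ)).eval (κ i)) i j) i j := by
    ext i j
    simp only [Matrix.of_apply, descPochhammer_eval_eq_prod_range]
    rw [sub_eq_add_neg (κ i) ((j : ℕ) : ℝ), Real.rpow_add hx]
    ring
  have hsum : ∑ i : Fin m, -((i : ℕ) : ℝ) = -((m : ℝ) * ((m : ℝ) - 1) / 2) := by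
    rw [Fin.sum_univ_eq_sum_range (fun i : ℕ => -(i : ℝ)) m]
    induction m with
    | zero => simp
    | succ n ih =>
      clear ih h1 κ
      induction n with
      | zero => simp
      | succ k ih => rw [Finset.sum_range_succ, ih]; push_cast; ring
  have hdet := Matrix.det_eval_matrixOfPolynomials_eq_det_vandermonde κ
    (fun j => descPochhammer ℝ (j : ℕ)) (fun i => descPochhammer_natDegree ℝ i)
    (fun i => monic_descPochhammer ℝ i)
  rw [h1, Matrix.det_mul_column, Matrix.det_mul_row, ← hdet, Matrix.det_vandermonde,
    ← mul_assoc, ← Real.rpow_sum_of_pos hx, ← Real.rpow_sum_of_pos hx, ← Real.rpow_add hx, hsum,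
    ← sub_eq_add_neg]
  congr 1
  refine Finset.prod_congr rfl fun i _ => Finset.prod_congr ?_ fun _ _ => rfl
  ext j
  simp
end

section
/- Let a, b ∈ ℂ, let U ⊆ ℂ∖{1} be open, and let f : ℂ → ℂ be holomorphic on U. Then for every z ∈ U, ((D − b/(z−1)) ∘ (D + (b−a)/(z−1)) ∘ (D + a/(z−1))) f (z) = f'''(z) + ((−a − b − a² − b² + a·b)/(z−1)²) · f'(z) + ((2a + 2a² − a·b + a²·b − a·b²)/(z−1)³) · f(z). -/
/-- The first-order differential operator `D + a`, sending `f` to `z ↦ f'(z) + a(z)·f(z)`. -/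
noncomputable def Dop (a : ℂ → ℂ) (f : ℂ → ℂ) : ℂ → ℂ := fun z => deriv f z + a z * f z

/-- Proposition 4.1 of the paper: expansion of
`(∂_z − b/(z−1))(∂_z + (b−a)/(z−1))(∂_z + a/(z−1))`, identifying the coefficients
`C = −a − b − a² − b² + ab` and `G = 2a + 2a² − ab + a²b − ab²`. -/
theorem su3_singular_factors_expansion
    (a b : ℂ) (U : Set ℂ) (hU : IsOpen U) (hU1 : (1 : ℂ) ∉ U) (f : ℂ → ℂ)
    (hf : DifferentiableOn ℂ f U) :
    ∀ z ∈ U,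
      Dop (fun z => -(b / (z - 1)))
          (Dop (fun z => (b - a) / (z - 1)) (Dop (fun z => a / (z - 1)) f)) z
        = deriv^[3] f z
          + ((-a - b - a ^ 2 - b ^ 2 + a * b) / (z - 1) ^ 2) * deriv f z
          + ((2 * a + 2 * a ^ 2 - a * b + a ^ 2 * b - a * b ^ 2) / (z - 1) ^ 3) * f z := by
  have hf1 : DifferentiableOn ℂ (deriv f) U := hf.deriv hU
  have hf2 : DifferentiableOn ℂ (deriv (deriv f)) U := hf1.deriv hU
  have hne : ∀ z ∈ U, z - 1 ≠ 0 := by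
    intro z hz h
    exact hU1 ((sub_eq_zero.mp h) ▸ hz)
  have hd : ∀ g : ℂ → ℂ, DifferentiableOn ℂ g U → ∀ z ∈ U, HasDerivAt g (deriv g z) z :=
    fun g hg z hz => (hg.differentiableAt (hU.mem_nhds hz)).hasDerivAt
  have hu : ∀ c : ℂ, ∀ z ∈ U, HasDerivAt (fun z : ℂ => c / (z - 1)) (-c / (z - 1) ^ 2) z := by
    intro c z hz
    have h := (hasDerivAt_const z c).div ((hasDerivAt_id z).sub_const 1) (hne z hz)
    refine h.congr_deriv ?_
    simp
  have hu2 : ∀ c : ℂ, ∀ z ∈ U,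
      HasDerivAt (fun z : ℂ => c / (z - 1) ^ 2) (-2 * c / (z - 1) ^ 3) z := by
    intro c z hz
    have h := (hasDerivAt_const z c).div (((hasDerivAt_id z).sub_const 1).pow 2)
      (pow_ne_zero 2 (hne z hz))
    refine h.congr_deriv ?_
    have := hne z hz
    simp
    field_simp
  have h2 : ∀ z ∈ U, Dop (fun z => (b - a) / (z - 1)) (Dop (fun z => a / (z - 1)) f) z
      = deriv (deriv f) z + b / (z - 1) * deriv f z
        + (a * b - a ^ 2 - a) / (z - 1) ^ 2 * f z := by
    intro z hz
    have h : HasDerivAt (Dop (fun z => a / (z - 1)) f) _ z :=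
      (hd _ hf1 z hz).add ((hu a z hz).mul (hd _ hf z hz))
    have := hne z hz
    rw [Dop, h.deriv, Dop]
    field_simp
    ring
  intro z hz
  have h3 := ((hd _ hf2 z hz).add ((hu b z hz).mul (hd _ hf1 z hz))).add
    ((hu2 (a * b - a ^ 2 - a) z hz).mul (hd _ hf z hz))
  have h4 := h3.congr_of_eventuallyEq (Filter.eventuallyEq_of_mem (hU.mem_nhds hz) h2)
  have := hne z hz
  rw [Dop, h4.deriv, h2 z hz]
  simp only [Function.iterate_succ, Function.iterate_zero, Function.comp_apply, id]
  field_simp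
  ring
end

section
/- Let τ, A, B, C, D₀, E, F, G ∈ ℂ, let U ⊆ ℂ∖{0,1} be open, and let f : ℂ → ℂ be holomorphic on U. Define the operator T by (T g)(z) = g'(z) − (τ/(z−1))·g(z). Then for every z ∈ U: (T∘T∘T) f (z) + (A/z² + B/(z(z−1)) + C/(z−1)²)·(T f)(z) + (D₀/z³ + E/(z²(z−1)) + F/(z(z−1)²) + G/(z−1)³)·f(z) = f'''(z) − (3τ/(z−1))·f''(z) + (A/z² + B/(z(z−1)) + (C + 3τ² + 3τ)/(z−1)²)·f'(z) + (D₀/z³ + (E − Aτ)/(z²(z−1)) + (F − Bτ)/(z(z−1)²) + (G − Cτ − τ³ − 3τ² − 2τ)/(z−1)³)·f(z). -/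
/-- The first-order operator `T = ∂_z − τ/(z−1)`. -/
noncomputable def Tshift (τ : ℂ) (f : ℂ → ℂ) : ℂ → ℂ := fun z => deriv f z - τ / (z - 1) * f z

theorem Tshift_hasDerivAt (τ : ℂ) (U : Set ℂ) (hU : IsOpen U) (hU1 : (1 : ℂ) ∉ U) (g : ℂ → ℂ)
    (hg : DifferentiableOn ℂ g U) (z : ℂ) (hz : z ∈ U) :
    HasDerivAt (Tshift τ g)
      (deriv (deriv g) z - (-τ / (z - 1) ^ 2 * g z + τ / (z - 1) * deriv g z)) z := by
  have hw : z - 1 ≠ 0 := fun h => hU1 (by rwa [← sub_eq_zero.mp h])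
  have h1 := (hg.differentiableAt (hU.mem_nhds hz)).hasDerivAt
  have h2 := ((hg.deriv hU).differentiableAt (hU.mem_nhds hz)).hasDerivAt
  have h3 : HasDerivAt (fun z : ℂ => τ / (z - 1)) (-τ / (z - 1) ^ 2) z := by
    have := (hasDerivAt_const z τ).div ((hasDerivAt_id z).sub_const 1) hw
    refine this.congr_deriv ?_
    simp
  exact h2.sub (h3.mul h1)

/-- equation (4.18) of the paper: the explicit expansion of the
`(z−1)^{−τ}`-shifted third-order Fuchsian operator, identifying the shifted coefficients
`C' = C + 3τ² + 3τ`, `E' = E − Aτ`, `F' = F − Bτ`, `G' = G − Cτ − τ³ − 3τ² − 2τ`. -/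
theorem su3_shifted_operator_expansion
    (τ A B C D₀ E F G : ℂ) (U : Set ℂ) (hU : IsOpen U)
    (hU0 : (0 : ℂ) ∉ U) (hU1 : (1 : ℂ) ∉ U) (f : ℂ → ℂ)
    (hf : DifferentiableOn ℂ f U) :
    ∀ z ∈ U,
      Tshift τ (Tshift τ (Tshift τ f)) z
          + (A / z ^ 2 + B / (z * (z - 1)) + C / (z - 1) ^ 2) * Tshift τ f z
          + (D₀ / z ^ 3 + E / (z ^ 2 * (z - 1)) + F / (z * (z - 1) ^ 2) + G / (z - 1) ^ 3)
              * f z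
        = deriv^[3] f z - 3 * τ / (z - 1) * deriv^[2] f z
          + (A / z ^ 2 + B / (z * (z - 1)) + (C + 3 * τ ^ 2 + 3 * τ) / (z - 1) ^ 2)
              * deriv f z
          + (D₀ / z ^ 3 + (E - A * τ) / (z ^ 2 * (z - 1)) + (F - B * τ) / (z * (z - 1) ^ 2)
              + (G - C * τ - τ ^ 3 - 3 * τ ^ 2 - 2 * τ) / (z - 1) ^ 3) * f z := by
  intro z hz
  have hw : z - 1 ≠ 0 := fun h => hU1 (by rwa [← sub_eq_zero.mp h])
  have hz0 : z ≠ 0 := fun h => hU0 (by rwa [← h])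
  have hT : ∀ g : ℂ → ℂ, DifferentiableOn ℂ g U → DifferentiableOn ℂ (Tshift τ g) U :=
    fun g hg x hx =>
      (Tshift_hasDerivAt τ U hU hU1 g hg x hx).differentiableAt.differentiableWithinAt
  have e1 : ∀ g : ℂ → ℂ, DifferentiableOn ℂ g U → ∀ x ∈ U, deriv (Tshift τ g) x =
      deriv (deriv g) x - (-τ / (x - 1) ^ 2 * g x + τ / (x - 1) * deriv g x) :=
    fun g hg x hx => (Tshift_hasDerivAt τ U hU hU1 g hg x hx).deriv
  have hf1 := hf.deriv hU
  have hf2 := hf1.deriv hU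
  have e2 : deriv (deriv (Tshift τ f)) z = deriv (deriv (deriv f)) z
      - ((2 * τ / (z - 1) ^ 3 * f z + -τ / (z - 1) ^ 2 * deriv f z)
        + (-τ / (z - 1) ^ 2 * deriv f z + τ / (z - 1) * deriv (deriv f) z)) := by
    have he : deriv (Tshift τ f) =ᶠ[nhds z] fun x =>
        deriv (deriv f) x - (-τ / (x - 1) ^ 2 * f x + τ / (x - 1) * deriv f x) := by
      filter_upwards [hU.mem_nhds hz] with x hx using e1 f hf x hx
    rw [he.deriv_eq]
    have d0 := (hf.differentiableAt (hU.mem_nhds hz)).hasDerivAt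
    have d1 := (hf1.differentiableAt (hU.mem_nhds hz)).hasDerivAt
    have d2 := (hf2.differentiableAt (hU.mem_nhds hz)).hasDerivAt
    have h3 : HasDerivAt (fun z : ℂ => τ / (z - 1)) (-τ / (z - 1) ^ 2) z := by
      have := (hasDerivAt_const z τ).div ((hasDerivAt_id z).sub_const 1) hw
      refine this.congr_deriv ?_
      simp
    have h4 : HasDerivAt (fun z : ℂ => -τ / (z - 1) ^ 2) (2 * τ / (z - 1) ^ 3) z := by
      have := (hasDerivAt_const z (-τ)).div (((hasDerivAt_id z).sub_const 1).pow 2)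
        (pow_ne_zero 2 hw)
      refine this.congr_deriv ?_
      simp only [id]
      field_simp
      norm_num
      ring
    exact (d2.sub ((h4.mul d0).add (h3.mul d1))).deriv
  have v : ∀ g : ℂ → ℂ, Tshift τ g z = deriv g z - τ / (z - 1) * g z := fun _ => rfl
  rw [v (Tshift τ (Tshift τ f)), e1 _ (hT f hf) z hz, v (Tshift τ f), e2, e1 f hf z hz, v f]
  simp only [Function.iterate_succ, Function.iterate_zero, Function.comp_apply, id]
  generalize deriv (deriv (deriv f)) z = a3
  generalize deriv (deriv f) z = a2
  generalize deriv f z = a1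
  generalize f z = a0
  field_simp
  ring
end
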